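/- For every integer n ≥ 1, the complete bipartite graph K_{n,n} satisfies φ(K_{n,n}) = 2 and A_b(K_{n,n}) = n + 1, so A_b(K_{n,n}) − φ(K_{n,n}) = n − 1; hence the difference between the acyclic b-chromatic number and the b-chromatic number of a graph can be arbitrarily large. -/

import Mathlib

open SimpleGraph

namespace AcyclicB

variable {V : Type*}

/-- `c` is a proper vertex coloring of `G`. -/
def Proper (G : SimpleGraph V) (c : V → ℕ) : Prop :=
  ∀ ⦃u v : V⦄, G.Adj u v → c u ≠ c v

/-- `c` is an acyclic (proper) coloring of `G`: the subgraph induced by the union of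
any two color classes is a forest. -/
def IsAcyclicColoring (G : SimpleGraph V) (c : V → ℕ) : Prop :=
  Proper G c ∧ ∀ i j : ℕ, (G.induce {v | c v = i ∨ c v = j}).IsAcyclic

/-- The closed neighborhood of `v` in `G`. -/
def closedNbhd (G : SimpleGraph V) (v : V) : Set V :=
  insert v (G.neighborSet v)

/-- `c'` is obtained from the acyclic coloring `c` by an acyclic recoloring step removing
one color `i`: every vertex of a color different from `i` keeps its color, and every vertex
of color `i` receives a color (among the colors of `c`, different from `i`) that is absent
from its closed neighborhood; the resulting coloring is again acyclic. -/
def RecolorStep (G : SimpleGraph V) (c' c : V → ℕ) : Prop :=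
  IsAcyclicColoring G c ∧ IsAcyclicColoring G c' ∧
  ∃ i ∈ Set.range c,
    (∀ v, c v ≠ i → c' v = c v) ∧
    (∀ v, c v = i → c' v ∈ Set.range c ∧ c' v ≠ i ∧
      ∀ u ∈ closedNbhd G v, c u ≠ c' v)

/-- The strict partial order `≺ₐ` on acyclic colorings: the transitive closure of the
acyclic recoloring step relation. -/
def StrictOrder (G : SimpleGraph V) : (V → ℕ) → (V → ℕ) → Prop :=
  Relation.TransGen (RecolorStep G)

/-- `c` is a minimal element of `≺ₐ`: an acyclic coloring admitting no acyclic recoloring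
step. -/
def IsMinimal (G : SimpleGraph V) (c : V → ℕ) : Prop :=
  IsAcyclicColoring G c ∧ ∀ c', ¬ RecolorStep G c' c

/-- The number of colors used by `c`. -/
def ncolors [Fintype V] (c : V → ℕ) : ℕ :=
  (Finset.univ.image c).card

/-- The acyclic b-chromatic number of `G`: the maximum number of colors used by a minimal
element of `≺ₐ`. -/
noncomputable def Ab [Fintype V] (G : SimpleGraph V) : ℕ :=
  sSup { k | ∃ c : V → ℕ, IsMinimal G c ∧ ncolors c = k }

/-- The acyclic chromatic number of `G`: the minimum number of colors in an acyclic
proper coloring. -/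
noncomputable def Achrom [Fintype V] (G : SimpleGraph V) : ℕ :=
  sInf { k | ∃ c : V → ℕ, IsAcyclicColoring G c ∧ ncolors c = k }

/-- The join of two graphs: disjoint copies of `G` and `H` together with all edges
between them. -/
def join {α β : Type*} (G : SimpleGraph α) (H : SimpleGraph β) : SimpleGraph (α ⊕ β) where
  Adj x y :=
    match x, y with
    | Sum.inl a, Sum.inl a' => G.Adj a a'
    | Sum.inr b, Sum.inr b' => H.Adj b b'
    | Sum.inl _, Sum.inr _ => True
    | Sum.inr _, Sum.inl _ => True
  symm := by
    refine ⟨?_⟩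
    rintro (a | b) (a' | b') h
    · exact G.adj_symm h
    · trivial
    · trivial
    · exact H.adj_symm h
  loopless := by
    refine ⟨?_⟩
    rintro (a | b) h
    · exact G.irrefl h
    · exact H.irrefl h

end AcyclicB

namespace AcyclicB

variable {V : Type*}

/-- A b-coloring of `G` with `k` colors: a proper coloring with colors `0, …, k − 1`
such that every color class contains a b-vertex, i.e. a vertex whose closed neighborhood
contains all `k` colors. -/
def IsBColoring (G : SimpleGraph V) (k : ℕ) (c : V → ℕ) : Prop :=
  (∀ v, c v < k) ∧ Proper G c ∧
  ∀ i < k, ∃ v, c v = i ∧ ∀ j < k, ∃ u ∈ closedNbhd G v, c u = j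

/-- The b-chromatic number of `G`: the largest `k` such that `G` admits a b-coloring
with `k` colors. -/
noncomputable def bChrom [Fintype V] (G : SimpleGraph V) : ℕ :=
  sSup { k | ∃ c : V → ℕ, IsBColoring G k c }

lemma completeBipartiteGraph_adj_iff {α β : Type*} {u v : α ⊕ β} :
    (completeBipartiteGraph α β).Adj u v ↔ u.isLeft ≠ v.isLeft := by
  cases u <;> cases v <;> simp

section CompleteBipartite

variable {α β : Type*} {c : α ⊕ β → ℕ} {s : Bool}

lemma proper_completeBipartiteGraph_iff :
    Proper (completeBipartiteGraph α β) c ↔ ∀ u v, u.isLeft ≠ v.isLeft → c u ≠ c v := by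
  simp only [Proper, completeBipartiteGraph_adj_iff]

/-- A proper coloring of a complete bipartite graph that is injective on one side is acyclic:
any two of its color classes span a star. -/
lemma IsAcyclicColoring.of_injOn_side (hc : Proper (completeBipartiteGraph α β) c)
    (hs : Set.InjOn c {v | v.isLeft = s}) :
    IsAcyclicColoring (completeBipartiteGraph α β) c := by
  refine ⟨hc, fun i j => ?_⟩
  rw [proper_completeBipartiteGraph_iff] at hc
  set H := (completeBipartiteGraph α β).induce {v | c v = i ∨ c v = j} with hH
  by_cases hbot : ∃ u v, H.Adj u v ∧ u.1.isLeft = s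
  · obtain ⟨u, w, huw, hu⟩ := hbot
    have center : ∀ x y, H.Adj x y → x.1.isLeft = s → x = u := by
      intro x y hxy hx
      simp only [hH, comap_adj, completeBipartiteGraph_adj_iff, Function.Embedding.subtype_apply]
        at huw hxy
      have h1 := hc u w huw
      have h2 := hc x w (by rwa [hx, ← hu])
      have h3 := u.2
      have h4 := w.2
      have h5 := x.2
      simp only [Set.mem_ofPred_eq] at h3 h4 h5
      exact Subtype.ext (hs hx hu (by lia))
    refine (isAcyclic_starGraph u).anti fun x y hxy => ?_
    rw [starGraph_adj]
    refine ⟨hxy.ne, ?_⟩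
    by_cases hx : x.1.isLeft = s
    · exact .inl (center x y hxy hx)
    · refine .inr (center y x hxy.symm ?_)
      simp only [hH, comap_adj, completeBipartiteGraph_adj_iff, Function.Embedding.subtype_apply]
        at hxy
      grind
  · have : H = ⊥ := by
      ext x y
      simp only [bot_adj, iff_false]
      intro hxy
      have h1 := fun h => hbot ⟨x, y, hxy, h⟩
      have h2 := fun h => hbot ⟨y, x, hxy.symm, h⟩
      simp only [hH, comap_adj, completeBipartiteGraph_adj_iff, Function.Embedding.subtype_apply]
        at hxy
      grind
    rw [this]
    exact isAcyclic_bot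

/-- Two monochromatic pairs on opposite sides would span a bichromatic 4-cycle. -/
lemma IsAcyclicColoring.exists_injOn_side
    (hc : IsAcyclicColoring (completeBipartiteGraph α β) c) :
    ∃ s : Bool, Set.InjOn c {v | v.isLeft = s} := by
  by_contra! h
  have hl := h true
  have hr := h false
  simp only [Set.InjOn, Set.mem_ofPred_eq, not_forall] at hl hr
  obtain ⟨a, ha, a', ha', haa, hane⟩ := hl
  obtain ⟨b, hb, b', hb', hbb, hbne⟩ := hr
  have hac := hc.2 (c a) (c b)
  set H := (completeBipartiteGraph α β).induce {v | c v = c a ∨ c v = c b} with hH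
  let A : {v | c v = c a ∨ c v = c b} := ⟨a, .inl rfl⟩
  let A' : {v | c v = c a ∨ c v = c b} := ⟨a', .inl haa.symm⟩
  let B : {v | c v = c a ∨ c v = c b} := ⟨b, .inr rfl⟩
  let B' : {v | c v = c a ∨ c v = c b} := ⟨b', .inr hbb.symm⟩
  have hadj : ∀ x y : {v | c v = c a ∨ c v = c b}, x.1.isLeft = true → y.1.isLeft = false →
      H.Adj x y := by
    intro x y hx hy
    rw [hH, comap_adj, completeBipartiteGraph_adj_iff]
    simp [hx, hy]
  have hAA : A ≠ A' := fun h => hane (congrArg Subtype.val h)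
  have hBB : B ≠ B' := fun h => hbne (congrArg Subtype.val h)
  have h1 := hadj A B ha hb
  have h2 := hadj A' B ha' hb
  have h3 := hadj A B' ha hb'
  have h4 := hadj A' B' ha' hb'
  let p : H.Path A A' := ⟨.cons h1 (.cons h2.symm .nil), by
    simp [Walk.cons_isPath_iff, hAA, h1.ne, h2.ne.symm]⟩
  let q : H.Path A A' := ⟨.cons h3 (.cons h4.symm .nil), by
    simp [Walk.cons_isPath_iff, hAA, h3.ne, h4.ne.symm]⟩
  have hpq : p.1.support = q.1.support := by
    rw [(hac.subsingleton_path A A').elim p q]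
  simp [p, q, hBB] at hpq

/-- In a minimal acyclic coloring, the side opposite to an injectively colored one is
monochromatic, since otherwise two of its colors could be merged. -/
lemma IsMinimal.eq_of_injOn_side (hc : IsMinimal (completeBipartiteGraph α β) c)
    (hs : Set.InjOn c {v | v.isLeft = s}) {u v : α ⊕ β}
    (hu : u.isLeft ≠ s) (hv : v.isLeft ≠ s) : c u = c v := by
  by_contra hne
  have hp := proper_completeBipartiteGraph_iff.1 hc.1.1
  have hside : ∀ x, c x = c u ∨ c x = c v → x.isLeft ≠ s := by
    intro x hx hxs
    rcases hx with hx | hx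
    · exact hp x u (by rw [hxs]; exact hu.symm) hx
    · exact hp x v (by rw [hxs]; exact hv.symm) hx
  let c' : α ⊕ β → ℕ := fun x => if c x = c u then c v else c x
  have hp' : Proper (completeBipartiteGraph α β) c' := by
    rw [proper_completeBipartiteGraph_iff]
    intro x y hxy
    have h1 := hp x y hxy
    have h2 := hside x
    have h3 := hside y
    simp only [c']
    grind
  have hs' : Set.InjOn c' {v | v.isLeft = s} := by
    intro x hx y hy hxy
    have h2 : c x ≠ c u := fun h => hside x (.inl h) hx
    have h3 : c y ≠ c u := fun h => hside y (.inl h) hy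
    simp only [c', if_neg h2, if_neg h3] at hxy
    exact hs hx hy hxy
  refine hc.2 c' ⟨hc.1, .of_injOn_side hp' hs', c u, ⟨u, rfl⟩, fun x hx => if_neg hx,
    fun x hx => ?_⟩
  have hcx : c' x = c v := if_pos hx
  rw [hcx]
  refine ⟨⟨v, rfl⟩, Ne.symm hne, fun y hy => ?_⟩
  rcases hy with rfl | hy
  · rwa [hx]
  · rw [mem_neighborSet, completeBipartiteGraph_adj_iff] at hy
    have h1 := hside x (.inl hx)
    refine hp y v fun h => hy ?_
    grind

/-- A coloring that is injective on one side and constant on the other is minimal. -/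
lemma IsMinimal.of_injOn_side (hc : Proper (completeBipartiteGraph α β) c)
    (hs : Set.InjOn c {v | v.isLeft = s})
    (hconst : ∀ u v : α ⊕ β, u.isLeft ≠ s → v.isLeft ≠ s → c u = c v)
    (hcard : ∀ u v : α ⊕ β, u.isLeft = s → v.isLeft = s → u ≠ v →
      ∃ x y : α ⊕ β, x.isLeft ≠ s ∧ y.isLeft ≠ s ∧ x ≠ y)
    (hne : ∃ w : α ⊕ β, w.isLeft = s) (hne' : ∃ w : α ⊕ β, w.isLeft ≠ s) :
    IsMinimal (completeBipartiteGraph α β) c := by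
  refine ⟨.of_injOn_side hc hs, ?_⟩
  rintro c' ⟨-, hc', _, ⟨u, rfl⟩, hkeep, hrec⟩
  rw [proper_completeBipartiteGraph_iff] at hc
  obtain ⟨⟨v, hv⟩, hvu, hnbhd⟩ := hrec u rfl
  obtain ⟨w, hw⟩ := hne
  obtain ⟨w', hw'⟩ := hne'
  have hnb : ∀ x : α ⊕ β, x.isLeft ≠ u.isLeft → c x ≠ c' u := fun x hx =>
    hnbhd x (.inr (completeBipartiteGraph_adj_iff.2 hx.symm))
  have hvside : v.isLeft = u.isLeft := by
    by_contra h
    exact hnb v h hv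
  by_cases hu : u.isLeft = s
  · have huv : v ≠ u := by
      rintro rfl
      exact hvu hv.symm
    have hcu : ∀ x : α ⊕ β, x.isLeft ≠ s → c' x = c x := fun x hx =>
      hkeep x (hc x u (by rwa [hu]))
    obtain ⟨x, y, hx, hy, hxy⟩ := hcard u v hu (hvside.trans hu) huv.symm
    have hv' : c' v = c v := hkeep v (by rw [hv]; exact hvu)
    obtain ⟨t, ht⟩ := hc'.exists_injOn_side
    by_cases hts : t = s
    · subst hts
      exact huv (ht (hvside.trans hu) hu (hv'.trans hv))
    · have hxt : x.isLeft = t := by grind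
      have hyt : y.isLeft = t := by grind
      exact hxy (ht hxt hyt (by rw [hcu x hx, hcu y hy, hconst x y hx hy]))
  · exact hvu (hv.symm.trans (hconst v u (hvside ▸ hu) hu))

/-- The number of colors of a coloring injective on the left and constant on the right. -/
lemma ncolors_eq_card_add_one [Fintype α] [Fintype β] (c : α ⊕ β → ℕ) (b : β)
    (hc : Proper (completeBipartiteGraph α β) c)
    (hl : Function.Injective (c ∘ Sum.inl)) (hr : ∀ b', c (.inr b') = c (.inr b)) :
    ncolors c = Fintype.card α + 1 := by
  classical
  rw [proper_completeBipartiteGraph_iff] at hc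
  have h : Finset.univ.image c =
      insert (c (.inr b)) (Finset.univ.image (c ∘ Sum.inl)) := by
    ext k
    simp only [Finset.mem_image, Finset.mem_univ, true_and, Finset.mem_insert, Sum.exists,
      Function.comp_apply]
    constructor
    · rintro (h | ⟨b', rfl⟩)
      · exact .inr h
      · exact .inl (hr b')
    · rintro (rfl | h)
      · exact .inr ⟨b, rfl⟩
      · exact .inl h
  rw [ncolors, h, Finset.card_insert_of_notMem, Finset.card_image_of_injective _ hl,
    Finset.card_univ]
  simp only [Finset.mem_image, Finset.mem_univ, true_and, not_exists, Function.comp_apply]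
  exact fun a => hc _ _ (by simp)

lemma ncolors_comp_swap [Fintype α] [Fintype β] (c : α ⊕ β → ℕ) :
    ncolors (c ∘ Sum.swap) = ncolors c := by
  classical
  unfold ncolors
  congr 1
  ext k
  simp [or_comm]

end CompleteBipartite

lemma IsMinimal.ncolors_eq {n : ℕ} (hn : 1 ≤ n) {c : Fin n ⊕ Fin n → ℕ}
    (hc : IsMinimal (completeBipartiteGraph (Fin n) (Fin n)) c) : ncolors c = n + 1 := by
  have hp := hc.1.1
  obtain ⟨s, hs⟩ := hc.1.exists_injOn_side
  cases s
  · rw [← ncolors_comp_swap, ncolors_eq_card_add_one _ ⟨0, hn⟩, Fintype.card_fin]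
    · rw [proper_completeBipartiteGraph_iff] at hp ⊢
      exact fun u v h => hp _ _ (by cases u <;> cases v <;> simp_all)
    · exact fun a b h => Sum.inr_injective (hs rfl rfl h)
    · exact fun b => hc.eq_of_injOn_side hs (by simp) (by simp)
  · rw [ncolors_eq_card_add_one c ⟨0, hn⟩ hp, Fintype.card_fin]
    · exact fun a b h => Sum.inl_injective (hs rfl rfl h)
    · exact fun b => hc.eq_of_injOn_side hs (by simp) (by simp)

theorem Ab_completeBipartiteGraph {n : ℕ} (hn : 1 ≤ n) :
    Ab (completeBipartiteGraph (Fin n) (Fin n)) = n + 1 := by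
  refine IsGreatest.csSup_eq ⟨?_, ?_⟩
  · suffices h : IsMinimal (completeBipartiteGraph (Fin n) (Fin n))
        (Sum.elim (fun a => (a : ℕ)) (fun _ => n)) from ⟨_, h, h.ncolors_eq hn⟩
    refine .of_injOn_side (s := true) ?_ ?_ ?_ ?_ ⟨.inl ⟨0, hn⟩, rfl⟩ ⟨.inr ⟨0, hn⟩, by simp⟩
    · rw [proper_completeBipartiteGraph_iff]
      rintro (a | a) (b | b) h <;> simp at h ⊢
      · exact a.isLt.ne
      · exact b.isLt.ne'
    · rintro (a | a) ha (b | b) hb h <;> simp_all [Fin.ext_iff]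
    · rintro (a | a) (b | b) <;> simp
    · rintro (a | a) (b | b) ha hb h
      · exact ⟨.inr a, .inr b, by simp, by simp, by simpa using h⟩
      all_goals simp at ha hb
  · rintro _ ⟨c, hc, rfl⟩
    exact (hc.ncolors_eq hn).le

/-- Two b-vertices on opposite sides show that a b-coloring of a complete bipartite graph
uses at most two colors. -/
lemma IsBColoring.le_two {α β : Type*} [Nonempty α] [Nonempty β] {k : ℕ} {c : α ⊕ β → ℕ}
    (hc : IsBColoring (completeBipartiteGraph α β) k c) : k ≤ 2 := by
  obtain ⟨hlt, hp, hb⟩ := hc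
  rw [proper_completeBipartiteGraph_iff] at hp
  have key : ∀ x : α ⊕ β, ∀ y : α ⊕ β, x.isLeft = y.isLeft → c x = c y := by
    intro x y hxy
    obtain ⟨v, hv, hvb⟩ := hb (c x) (hlt x)
    have hvx : v.isLeft = x.isLeft := by
      by_contra h
      exact hp v x h hv
    obtain ⟨u, hu, huy⟩ := hvb (c y) (hlt y)
    rcases hu with rfl | hu
    · exact hv.symm.trans huy
    · rw [mem_neighborSet, completeBipartiteGraph_adj_iff] at hu
      exact absurd huy (hp u y (by rw [← hxy, ← hvx]; exact hu.symm))
  obtain ⟨a⟩ := ‹Nonempty α›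
  obtain ⟨b⟩ := ‹Nonempty β›
  have hcol : ∀ i < k, i = c (.inl a) ∨ i = c (.inr b) := by
    intro i hi
    obtain ⟨v, rfl, -⟩ := hb i hi
    cases v
    · exact .inl (key _ _ rfl)
    · exact .inr (key _ _ rfl)
  by_contra! hk
  have h0 := hcol 0 (by lia)
  have h1 := hcol 1 (by lia)
  have h2 := hcol 2 (by lia)
  lia

theorem bChrom_completeBipartiteGraph {α β : Type*} [Fintype α] [Fintype β] [Nonempty α]
    [Nonempty β] : bChrom (completeBipartiteGraph α β) = 2 := by
  refine IsGreatest.csSup_eq ⟨⟨Sum.elim (fun _ => 0) (fun _ => 1), ?_, ?_, ?_⟩, ?_⟩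
  · rintro (_ | _) <;> simp
  · rw [proper_completeBipartiteGraph_iff]
    rintro (_ | _) (_ | _) <;> simp
  · obtain ⟨a⟩ := ‹Nonempty α›
    obtain ⟨b⟩ := ‹Nonempty β›
    intro i hi
    interval_cases i
    · refine ⟨.inl a, rfl, fun j hj => ?_⟩
      interval_cases j
      · exact ⟨.inl a, .inl rfl, rfl⟩
      · exact ⟨.inr b, .inr (by simp), rfl⟩
    · refine ⟨.inr b, rfl, fun j hj => ?_⟩
      interval_cases j
      · exact ⟨.inl a, .inr (by simp), rfl⟩
      · exact ⟨.inr b, .inl rfl, rfl⟩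
  · rintro k ⟨c, hc⟩
    exact hc.le_two

/-- For every `n ≥ 1`, `φ(K_{n,n}) = 2` and `A_b(K_{n,n}) = n + 1`, so
`A_b(K_{n,n}) − φ(K_{n,n}) = n − 1`: the difference between the acyclic b-chromatic
number and the b-chromatic number can be arbitrarily large. -/
theorem ab_sub_bChrom_unbounded (n : ℕ) (hn : 1 ≤ n) :
    bChrom (completeBipartiteGraph (Fin n) (Fin n)) = 2 ∧
    Ab (completeBipartiteGraph (Fin n) (Fin n)) = n + 1 ∧
    Ab (completeBipartiteGraph (Fin n) (Fin n))
      - bChrom (completeBipartiteGraph (Fin n) (Fin n)) = n - 1 := by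
  have : Nonempty (Fin n) := ⟨⟨0, hn⟩⟩
  rw [bChrom_completeBipartiteGraph, Ab_completeBipartiteGraph hn]
  exact ⟨rfl, rfl, by lia⟩

end AcyclicB
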